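/- Let σ: S ↷ G be a non-automorphic algebraic action. The following conditions are equivalent: (M0) the only nonempty closed I-invariant subset of ∂Ê is ∂Ê itself (i.e. the tight groupoid 𝒢_σ is minimal); (M1) for all C, D ∈ 𝒞 there exist φ₁, …, φ_n ∈ I with C ⊆ ⋃ᵢ φᵢ(dom(φᵢ) ∩ D); (M2) for all D ∈ 𝒞 there exist φ₁, …, φ_n ∈ I with G = ⋃ᵢ φᵢ(dom(φᵢ) ∩ D); (M3) for all C, D ∈ 𝒞 there exist φ ∈ I^e and D' ∈ 𝒞 with D' ⊆ D ∩ dom(φ), φ(D') ⊆ C and [C : φ(D')] < ∞; (M4) for all D ∈ 𝒞 there exist φ ∈ I^e and D' ∈ 𝒞 with D' ⊆ D ∩ dom(φ) and [G : φ(D')] < ∞; (M5) 𝔽_𝒞 contains no nonempty proper I^e-invariant, ⊆-closed subset. -/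

import Mathlib

open scoped Pointwise

/-- The family of `S`-constructible subgroups of `G`. -/
inductive IsConstructible {S G : Type*} [Monoid S] [Group G]
    (σ : S →* Monoid.End G) : Subgroup G → Prop
  | top : IsConstructible σ ⊤
  | map : ∀ (s : S) (C : Subgroup G), IsConstructible σ C →
      IsConstructible σ (Subgroup.map (σ s) C)
  | comap : ∀ (s : S) (C : Subgroup G), IsConstructible σ C →
      IsConstructible σ (Subgroup.comap (σ s) C)

/- We model partial bijections of `G` by their graphs, i.e. subsets of `G × G`
that are graphs of injective partial functions; equality of graphs is exactly
equality of partial bijections. -/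

/-- Graph of an everywhere-defined function. -/
def grph {G : Type*} (f : G → G) : Set (G × G) := {p | p.2 = f p.1}

/-- Composition `φ ∘ ψ` of partial bijections (apply `ψ` first), as graphs. -/
def rcomp {G : Type*} (φ ψ : Set (G × G)) : Set (G × G) :=
  {p | ∃ y, (p.1, y) ∈ ψ ∧ (y, p.2) ∈ φ}

/-- Inverse of a partial bijection, as graphs. -/
def rinv {G : Type*} (φ : Set (G × G)) : Set (G × G) := {p | (p.2, p.1) ∈ φ}

/-- Domain of a partial bijection. -/
def rdom {G : Type*} (φ : Set (G × G)) : Set G := {x | ∃ y, (x, y) ∈ φ}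

/-- The identity map on a subset `A ⊆ G`, as a graph. -/
def idOn {G : Type*} (A : Set G) : Set (G × G) := {p | p.1 = p.2 ∧ p.1 ∈ A}

/-- Membership in the inverse semigroup of partial bijections generated by a
set of generators: closure under composition and inversion. -/
inductive MemInvSemigroup {G : Type*} (gens : Set (Set (G × G))) : Set (G × G) → Prop
  | base : ∀ φ ∈ gens, MemInvSemigroup gens φ
  | comp : ∀ φ ψ, MemInvSemigroup gens φ → MemInvSemigroup gens ψ →
      MemInvSemigroup gens (rcomp φ ψ)
  | inv : ∀ φ, MemInvSemigroup gens φ → MemInvSemigroup gens (rinv φ)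

/-- The inverse semigroup `I` generated by the endomorphisms `σ_s` and the left
translations `t_g`. -/
def memI {S G : Type*} [Monoid S] [Group G] (σ : S →* Monoid.End G) :
    Set (G × G) → Prop :=
  MemInvSemigroup ({φ | ∃ s : S, φ = grph (σ s : G → G)} ∪
    {φ | ∃ g : G, φ = grph (fun h : G => g * h)})


/-- The inverse semigroup `I^e` generated by the endomorphisms `σ_s` alone. -/
def memIe {S G : Type*} [Monoid S] [Group G] (σ : S →* Monoid.End G) :
    Set (G × G) → Prop :=
  MemInvSemigroup {φ | ∃ s : S, φ = grph (σ s : G → G)}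
def ECoset {S G : Type*} [Monoid S] [Group G] (σ : S →* Monoid.End G) : Set (Set G) :=
  {E | E = ∅ ∨ ∃ (g : G) (C : Subgroup G), IsConstructible σ C ∧ E = g • (C : Set G)}

/-- A character of `ℰ`: multiplicative, sends `∅` to `0` and `G` to `1`.
(We represent characters as Boolean functions on `Set G`, pinned to `false`
outside `ℰ`, so that equality of characters is equality of functions and the
topology of pointwise convergence is the product topology.) -/
def IsChar {S G : Type*} [Monoid S] [Group G] (σ : S →* Monoid.End G)
    (χ : Set G → Bool) : Prop :=
  χ ∅ = false ∧ χ Set.univ = true ∧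
  (∀ E F : Set G, E ∈ ECoset σ → F ∈ ECoset σ → χ (E ∩ F) = (χ E && χ F)) ∧
  (∀ E : Set G, E ∉ ECoset σ → χ E = false)

/-- The filter of a character: the collection of elements of `ℰ` on which it is `1`. -/
def charFilter {G : Type*} (χ : Set G → Bool) : Set (Set G) := {E | χ E = true}

/-- A character is maximal if its filter is maximal with respect to inclusion. -/
def IsMaxChar {S G : Type*} [Monoid S] [Group G] (σ : S →* Monoid.End G)
    (χ : Set G → Bool) : Prop :=
  IsChar σ χ ∧ ∀ ω : Set G → Bool, IsChar σ ω → charFilter χ ⊆ charFilter ω →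
    charFilter ω = charFilter χ

/-- The boundary `∂Ê`: the closure of the set of maximal characters, inside the
character space `Ê`. -/
def Boundary {S G : Type*} [Monoid S] [Group G] (σ : S →* Monoid.End G) :
    Set (Set G → Bool) :=
  {χ | IsChar σ χ} ∩ closure {χ : Set G → Bool | IsMaxChar σ χ}

/-- `𝔉(χ)`: the filter on `𝒞` induced by a character `χ`, consisting of those
constructible subgroups `C` with `χ(gC) = 1` for some `g`. -/
def FilC {S G : Type*} [Monoid S] [Group G] (σ : S →* Monoid.End G)
    (χ : Set G → Bool) : Set (Subgroup G) :=
  {C | IsConstructible σ C ∧ ∃ g : G, χ (g • (C : Set G)) = true}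

/-- Image of a set under a partial bijection (given as a graph). -/
def rimg {G : Type*} (φ : Set (G × G)) (E : Set G) : Set G := {y | ∃ x ∈ E, (x, y) ∈ φ}

/-- Preimage of a set under a partial bijection: `φ⁻¹(E ∩ im φ)`. -/
def preimRel {G : Type*} (φ : Set (G × G)) (E : Set G) : Set G :=
  {x | ∃ y ∈ E, (x, y) ∈ φ}

open Classical in
/-- The action of `φ ∈ I` on characters: `(φ.χ)(E) = χ(φ⁻¹(E ∩ im φ))` for
`E ∈ ℰ` (and `false` off `ℰ`, matching our representation of characters). -/
noncomputable def charAct {S G : Type*} [Monoid S] [Group G] (σ : S →* Monoid.End G)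
    (φ : Set (G × G)) (χ : Set G → Bool) : Set G → Bool :=
  fun E => if E ∈ ECoset σ then χ (preimRel φ E) else false

/-- A subset `𝔛 ⊆ ∂Ê` is `I`-invariant if `φ.χ ∈ 𝔛` whenever `φ ∈ I`, `χ ∈ 𝔛`
and `χ(dom φ) = 1`. -/
def IsInvariantSet {S G : Type*} [Monoid S] [Group G] (σ : S →* Monoid.End G)
    (𝔛 : Set (Set G → Bool)) : Prop :=
  ∀ φ : Set (G × G), memI σ φ → ∀ χ ∈ 𝔛, χ (rdom φ) = true → charAct σ φ χ ∈ 𝔛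

/-- A finitely hereditary filter on the semilattice `𝒞` of constructible
subgroups: contains `G = ⊤`, closed under intersections, upward closed in `𝒞`,
and containing with each member all its finite-index constructible subgroups. -/
def FinHerFilter {S G : Type*} [Monoid S] [Group G] (σ : S →* Monoid.End G)
    (𝔉 : Set (Subgroup G)) : Prop :=
  (∀ C ∈ 𝔉, IsConstructible σ C) ∧ (⊤ : Subgroup G) ∈ 𝔉 ∧
  (∀ C ∈ 𝔉, ∀ D ∈ 𝔉, C ⊓ D ∈ 𝔉) ∧
  (∀ C ∈ 𝔉, ∀ D : Subgroup G, IsConstructible σ D → C ≤ D → D ∈ 𝔉) ∧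
  (∀ C ∈ 𝔉, ∀ D : Subgroup G, IsConstructible σ D → D ≤ C → D.relIndex C ≠ 0 → D ∈ 𝔉)

/-- The generating set for the action of `φ ∈ I^e` on a filter `𝔉`:
the images `φ(D)` for `D ∈ 𝔉` contained in `dom φ`. -/
def filterActGens {S G : Type*} [Monoid S] [Group G] (σ : S →* Monoid.End G)
    (φ : Set (G × G)) (𝔉 : Set (Subgroup G)) : Set (Subgroup G) :=
  {B | ∃ D ∈ 𝔉, (D : Set G) ⊆ rdom φ ∧ (B : Set G) = rimg φ (D : Set G)}

/-- `𝔊` is the smallest finitely hereditary filter containing a given family. -/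
def IsSmallestFHF {S G : Type*} [Monoid S] [Group G] (σ : S →* Monoid.End G)
    (A : Set (Subgroup G)) (𝔊 : Set (Subgroup G)) : Prop :=
  FinHerFilter σ 𝔊 ∧ A ⊆ 𝔊 ∧
    ∀ 𝔊' : Set (Subgroup G), FinHerFilter σ 𝔊' → A ⊆ 𝔊' → 𝔊 ⊆ 𝔊'

/-- A set `𝔽` of finitely hereditary filters is `I^e`-invariant if it is closed
under the partial action of `I^e`: whenever `φ.𝔉` is defined (i.e. some
`C ∈ 𝔉` satisfies `C ⊆ dom φ`), the resulting filter `φ.𝔉` belongs to `𝔽`. -/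
def IeInvariant {S G : Type*} [Monoid S] [Group G] (σ : S →* Monoid.End G)
    (𝔽 : Set (Set (Subgroup G))) : Prop :=
  ∀ 𝔉 ∈ 𝔽, ∀ φ : Set (G × G), memIe σ φ →
    (∃ C ∈ 𝔉, (C : Set G) ⊆ rdom φ) →
    ∀ 𝔊 : Set (Subgroup G), IsSmallestFHF σ (filterActGens σ φ 𝔉) 𝔊 → 𝔊 ∈ 𝔽

/-- A set `𝔽` of finitely hereditary filters is `⊆`-closed if every finitely
hereditary filter contained in `⋃_{𝔉 ∈ 𝔽} 𝔉` belongs to `𝔽`. -/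
def SubsetClosed {S G : Type*} [Monoid S] [Group G] (σ : S →* Monoid.End G)
    (𝔽 : Set (Set (Subgroup G))) : Prop :=
  ∀ 𝔈 : Set (Subgroup G), FinHerFilter σ 𝔈 →
    (∀ C ∈ 𝔈, ∃ 𝔉 ∈ 𝔽, C ∈ 𝔉) → 𝔈 ∈ 𝔽

section PartialBijections

variable {G : Type*}

theorem rimg_rcomp (φ ψ : Set (G × G)) (E : Set G) :
    rimg (rcomp φ ψ) E = rimg φ (rimg ψ E) := by
  ext z
  constructor
  · rintro ⟨x, hx, y, hxy, hyz⟩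
    exact ⟨y, ⟨x, hx, hxy⟩, hyz⟩
  · rintro ⟨y, ⟨x, hx, hxy⟩, hyz⟩
    exact ⟨x, hx, y, hxy, hyz⟩

theorem rinv_rinv (φ : Set (G × G)) : rinv (rinv φ) = φ := rfl

theorem rimg_rinv (φ : Set (G × G)) (E : Set G) : rimg (rinv φ) E = preimRel φ E := rfl

theorem rinv_rcomp (φ ψ : Set (G × G)) : rinv (rcomp φ ψ) = rcomp (rinv ψ) (rinv φ) := by
  ext p
  constructor <;> rintro ⟨y, h₁, h₂⟩ <;> exact ⟨y, h₂, h₁⟩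

theorem rimg_grph (f : G → G) (E : Set G) : rimg (grph f) E = f '' E := by
  ext y
  constructor
  · rintro ⟨x, hx, rfl : y = f x⟩
    exact ⟨x, hx, rfl⟩
  · rintro ⟨x, hx, rfl⟩
    exact ⟨x, hx, rfl⟩

theorem preimRel_grph (f : G → G) (E : Set G) : preimRel (grph f) E = f ⁻¹' E := by
  ext x
  constructor
  · rintro ⟨y, hy, rfl : y = f x⟩
    exact hy
  · intro hx
    exact ⟨f x, hx, rfl⟩

theorem rimg_rdom_inter (φ : Set (G × G)) (E : Set G) : rimg φ (rdom φ ∩ E) = rimg φ E := by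
  ext y
  constructor
  · rintro ⟨x, ⟨-, hx⟩, hxy⟩
    exact ⟨x, hx, hxy⟩
  · rintro ⟨x, hx, hxy⟩
    exact ⟨x, ⟨⟨y, hxy⟩, hx⟩, hxy⟩

theorem preimRel_empty (φ : Set (G × G)) : preimRel φ ∅ = ∅ := by
  ext x
  constructor
  · rintro ⟨y, hy, -⟩
    exact hy
  · exact False.elim

theorem preimRel_univ (φ : Set (G × G)) : preimRel φ Set.univ = rdom φ := by
  ext x
  constructor
  · rintro ⟨y, -, hy⟩
    exact ⟨y, hy⟩
  · rintro ⟨y, hy⟩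
    exact ⟨y, trivial, hy⟩

theorem preimRel_subset_rdom (φ : Set (G × G)) (E : Set G) : preimRel φ E ⊆ rdom φ := by
  rintro x ⟨y, -, hy⟩
  exact ⟨y, hy⟩

theorem rimg_mono (φ : Set (G × G)) {E F : Set G} (h : E ⊆ F) : rimg φ E ⊆ rimg φ F := by
  rintro y ⟨x, hx, hxy⟩
  exact ⟨x, h hx, hxy⟩

/-- The relation is the graph of an injective partial function. -/
def IsPartialBij (φ : Set (G × G)) : Prop :=
  (∀ x y y', (x, y) ∈ φ → (x, y') ∈ φ → y = y') ∧
    ∀ x x' y, (x, y) ∈ φ → (x', y) ∈ φ → x = x'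

theorem IsPartialBij.rinv {φ : Set (G × G)} (h : IsPartialBij φ) : IsPartialBij (rinv φ) :=
  ⟨fun x y y' h₁ h₂ => h.2 y y' x h₁ h₂, fun x x' y h₁ h₂ => h.1 y x x' h₁ h₂⟩

theorem IsPartialBij.rcomp {φ ψ : Set (G × G)} (hφ : IsPartialBij φ) (hψ : IsPartialBij ψ) :
    IsPartialBij (rcomp φ ψ) := by
  constructor
  · rintro x z z' ⟨y, h₁, h₂⟩ ⟨y', h₁', h₂'⟩
    obtain rfl := hψ.1 x y y' h₁ h₁'
    exact hφ.1 y z z' h₂ h₂'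
  · rintro x x' z ⟨y, h₁, h₂⟩ ⟨y', h₁', h₂'⟩
    obtain rfl := hφ.2 y y' z h₂ h₂'
    exact hψ.2 x x' y h₁ h₁'

theorem isPartialBij_grph {f : G → G} (hf : Function.Injective f) : IsPartialBij (grph f) := by
  constructor
  · rintro x y y' (rfl : y = f x) (rfl : y' = f x)
    rfl
  · rintro x x' y (rfl : y = f x) (h : f x = f x')
    exact hf h

theorem IsPartialBij.preimRel_inter {φ : Set (G × G)} (hφ : IsPartialBij φ) (E F : Set G) :
    preimRel φ (E ∩ F) = preimRel φ E ∩ preimRel φ F := by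
  ext x
  constructor
  · rintro ⟨y, ⟨h₁, h₂⟩, h⟩
    exact ⟨⟨y, h₁, h⟩, y, h₂, h⟩
  · rintro ⟨⟨y, h₁, h⟩, y', h₂, h'⟩
    obtain rfl := hφ.1 x y y' h h'
    exact ⟨y, ⟨h₁, h₂⟩, h⟩

theorem IsPartialBij.preimRel_rimg {φ : Set (G × G)} (hφ : IsPartialBij φ) (E : Set G) :
    preimRel φ (rimg φ E) = E ∩ rdom φ := by
  ext x
  constructor
  · rintro ⟨y, ⟨x', hx', h'⟩, h⟩
    obtain rfl := hφ.2 x x' y h h'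
    exact ⟨hx', y, h⟩
  · rintro ⟨hx, y, h⟩
    exact ⟨y, ⟨x, hx, h⟩, h⟩

theorem IsPartialBij.rimg_preimRel {φ : Set (G × G)} (hφ : IsPartialBij φ) (E : Set G) :
    rimg φ (preimRel φ E) = E ∩ rdom (_root_.rinv φ) :=
  hφ.rinv.preimRel_rimg E

end PartialBijections

section Constructible

variable {S G : Type*} [Monoid S] [Group G] {σ : S →* Monoid.End G}

theorem IsConstructible.inf (hinj : ∀ s : S, Function.Injective (σ s)) {C D : Subgroup G}
    (hC : IsConstructible σ C) (hD : IsConstructible σ D) : IsConstructible σ (C ⊓ D) := by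
  induction hC generalizing D with
  | top => simpa using hD
  | map s C _ ih =>
    have h : Subgroup.map (σ s) C ⊓ D = Subgroup.map (σ s) (C ⊓ Subgroup.comap (σ s) D) := by
      ext x
      constructor
      · rintro ⟨⟨c, hc, rfl⟩, hx⟩
        exact ⟨c, ⟨hc, hx⟩, rfl⟩
      · rintro ⟨c, ⟨hc, hx⟩, rfl⟩
        exact ⟨⟨c, hc, rfl⟩, hx⟩
    rw [h]
    exact .map s _ (ih (.comap s D hD))
  | comap s C _ ih =>
    have h : Subgroup.comap (σ s) C ⊓ D = Subgroup.comap (σ s) (C ⊓ Subgroup.map (σ s) D) := by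
      ext x
      constructor
      · rintro ⟨h₁, h₂⟩
        exact ⟨h₁, x, h₂, rfl⟩
      · rintro ⟨h₁, y, h₂, h₃⟩
        obtain rfl := hinj s h₃
        exact ⟨h₁, h₂⟩
    rw [h]
    exact .comap s _ (ih (.map s D hD))

theorem memIe.memI {φ : Set (G × G)} (hφ : memIe σ φ) : memI σ φ := by
  induction hφ with
  | base φ h => exact .base φ (Or.inl h)
  | comp φ ψ _ _ h₁ h₂ => exact .comp φ ψ h₁ h₂
  | inv φ _ h => exact .inv φ h

theorem memI.isPartialBij (hinj : ∀ s : S, Function.Injective (σ s)) {φ : Set (G × G)}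
    (hφ : memI σ φ) : IsPartialBij φ := by
  induction hφ with
  | base φ h =>
    rcases h with ⟨s, rfl⟩ | ⟨g, rfl⟩
    · exact isPartialBij_grph (hinj s)
    · exact isPartialBij_grph (mul_right_injective g)
  | comp φ ψ _ _ h₁ h₂ => exact h₁.rcomp h₂
  | inv φ _ h => exact h.rinv

theorem memIe.isPartialBij (hinj : ∀ s : S, Function.Injective (σ s)) {φ : Set (G × G)}
    (hφ : memIe σ φ) : IsPartialBij φ :=
  hφ.memI.isPartialBij hinj

variable (σ) in
theorem memIe_grph_id : memIe σ (grph (id : G → G)) :=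
  .base _ ⟨1, by rw [map_one]; rfl⟩

variable (σ) in
theorem memI_grph_mul_left (g : G) : memI σ (grph fun h : G => g * h) :=
  .base _ (Or.inr ⟨g, rfl⟩)

theorem memIe.exists_subgroup {φ : Set (G × G)} (hφ : memIe σ φ) :
    ∃ Γ : Subgroup (G × G), (Γ : Set (G × G)) = φ := by
  induction hφ with
  | base φ h =>
    obtain ⟨s, rfl⟩ := h
    refine ⟨{ carrier := grph (σ s), mul_mem' := ?_, one_mem' := ?_, inv_mem' := ?_ }, rfl⟩
    · rintro ⟨a, b⟩ ⟨c, d⟩ (rfl : b = σ s a) (rfl : d = σ s c)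
      exact (map_mul (σ s) a c).symm
    · exact (map_one (σ s)).symm
    · rintro ⟨a, b⟩ (rfl : b = σ s a)
      exact (map_inv (σ s) a).symm
  | comp φ ψ _ _ h₁ h₂ =>
    obtain ⟨Γ, rfl⟩ := h₁
    obtain ⟨Δ, rfl⟩ := h₂
    refine ⟨{ carrier := rcomp Γ Δ, mul_mem' := ?_, one_mem' := ?_, inv_mem' := ?_ }, rfl⟩
    · rintro a b ⟨y, h₁, h₂⟩ ⟨z, h₃, h₄⟩
      exact ⟨y * z, Δ.mul_mem h₁ h₃, Γ.mul_mem h₂ h₄⟩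
    · exact ⟨1, Δ.one_mem, Γ.one_mem⟩
    · rintro a ⟨y, h₁, h₂⟩
      exact ⟨y⁻¹, Δ.inv_mem h₁, Γ.inv_mem h₂⟩
  | inv φ _ h =>
    obtain ⟨Γ, rfl⟩ := h
    refine ⟨{ carrier := rinv Γ, mul_mem' := ?_, one_mem' := ?_, inv_mem' := ?_ }, rfl⟩
    · exact fun h₁ h₂ => Γ.mul_mem h₁ h₂
    · exact Γ.one_mem
    · exact fun h₁ => Γ.inv_mem h₁

theorem memIe.exists_constructible_rimg_and_preimRel {φ : Set (G × G)} (hφ : memIe σ φ) :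
    (∀ C : Subgroup G, IsConstructible σ C →
      ∃ B : Subgroup G, IsConstructible σ B ∧ (B : Set G) = rimg φ C) ∧
    ∀ C : Subgroup G, IsConstructible σ C →
      ∃ B : Subgroup G, IsConstructible σ B ∧ (B : Set G) = preimRel φ C := by
  induction hφ with
  | base φ h =>
    obtain ⟨s, rfl⟩ := h
    refine ⟨fun C hC => ⟨_, .map s C hC, ?_⟩, fun C hC => ⟨_, .comap s C hC, ?_⟩⟩
    · rw [rimg_grph]; rfl
    · rw [preimRel_grph]; rfl
  | comp φ ψ _ _ h₁ h₂ =>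
    constructor
    · intro C hC
      obtain ⟨B, hB, hBC⟩ := h₂.1 C hC
      obtain ⟨A, hA, hAB⟩ := h₁.1 B hB
      exact ⟨A, hA, by rw [hAB, hBC, rimg_rcomp]⟩
    · intro C hC
      obtain ⟨B, hB, hBC⟩ := h₁.2 C hC
      obtain ⟨A, hA, hAB⟩ := h₂.2 B hB
      refine ⟨A, hA, ?_⟩
      rw [hAB, hBC, ← rimg_rinv, ← rimg_rinv, ← rimg_rinv, rinv_rcomp, rimg_rcomp]
  | inv φ _ h => exact ⟨h.2, h.1⟩

theorem memIe.exists_constructible_rimg {φ : Set (G × G)} (hφ : memIe σ φ) {C : Subgroup G}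
    (hC : IsConstructible σ C) :
    ∃ B : Subgroup G, IsConstructible σ B ∧ (B : Set G) = rimg φ C :=
  hφ.exists_constructible_rimg_and_preimRel.1 C hC

theorem memIe.exists_constructible_preimRel {φ : Set (G × G)} (hφ : memIe σ φ) {C : Subgroup G}
    (hC : IsConstructible σ C) :
    ∃ B : Subgroup G, IsConstructible σ B ∧ (B : Set G) = preimRel φ C :=
  hφ.exists_constructible_rimg_and_preimRel.2 C hC

/-- Partial isomorphisms in `I^e` preserve indices. -/
theorem memIe.relIndex_eq (hinj : ∀ s : S, Function.Injective (σ s)) {φ : Set (G × G)}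
    (hφ : memIe σ φ) {C D C' D' : Subgroup G} (hC : (C : Set G) ⊆ rdom φ)
    (hC' : (C' : Set G) = rimg φ C) (hD' : (D' : Set G) = rimg φ D) :
    D'.relIndex C' = D.relIndex C := by
  have hbij := hφ.isPartialBij hinj
  obtain ⟨Γ, rfl⟩ := hφ.exists_subgroup
  let Δ : Subgroup (G × G) := Γ ⊓ C.comap (MonoidHom.fst G G)
  have h₁ : Δ.map (MonoidHom.fst G G) = C := by
    ext x
    constructor
    · rintro ⟨p, ⟨-, hp⟩, rfl⟩
      exact hp
    · intro hx
      obtain ⟨y, hy⟩ := hC hx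
      exact ⟨(x, y), ⟨hy, hx⟩, rfl⟩
  have h₂ : Δ.map (MonoidHom.snd G G) = C' := by
    refine SetLike.coe_injective ?_
    rw [hC']
    ext y
    constructor
    · rintro ⟨⟨x, y⟩, ⟨hp, hx⟩, rfl⟩
      exact ⟨x, hx, hp⟩
    · rintro ⟨x, hx, hp⟩
      exact ⟨(x, y), ⟨hp, hx⟩, rfl⟩
  have h₃ : D'.comap (MonoidHom.snd G G) ⊓ Δ = D.comap (MonoidHom.fst G G) ⊓ Δ := by
    ext ⟨x, y⟩
    constructor
    · rintro ⟨hy, hΔ⟩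
      refine ⟨?_, hΔ⟩
      have hy' : y ∈ (D' : Set G) := hy
      rw [hD'] at hy'
      obtain ⟨x', hx', h⟩ := hy'
      obtain rfl := hbij.2 x x' y hΔ.1 h
      exact hx'
    · rintro ⟨hx, hΔ⟩
      refine ⟨?_, hΔ⟩
      change y ∈ (D' : Set G)
      rw [hD']
      exact ⟨x, hx, hΔ.1⟩
  rw [← h₂, ← Subgroup.relIndex_comap, ← Subgroup.inf_relIndex_right, h₃,
    Subgroup.inf_relIndex_right, Subgroup.relIndex_comap, h₁]

/-- A nonempty element of `I` is a left coset, in `G × G`, of an element of `I^e`. -/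
theorem memI.exists_memIe {φ : Set (G × G)} (hφ : memI σ φ) :
    ∃ ψ, memIe σ ψ ∧ ∀ x₀ y₀, (x₀, y₀) ∈ φ →
      ∀ x y, (x₀ * x, y₀ * y) ∈ φ ↔ (x, y) ∈ ψ := by
  induction hφ with
  | base φ h =>
    rcases h with ⟨s, rfl⟩ | ⟨g, rfl⟩
    · refine ⟨_, .base _ ⟨s, rfl⟩, ?_⟩
      rintro x₀ y₀ (rfl : y₀ = σ s x₀) x y
      simp [grph]
    · refine ⟨_, memIe_grph_id σ, ?_⟩
      rintro x₀ y₀ (rfl : y₀ = g * x₀) x y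
      simp [grph, mul_assoc]
  | comp φ φ' _ _ h₁ h₂ =>
    obtain ⟨ψ, hψ, h⟩ := h₁
    obtain ⟨ψ', hψ', h'⟩ := h₂
    refine ⟨_, .comp ψ ψ' hψ hψ', ?_⟩
    rintro x₀ z₀ ⟨y₀, h₁, h₂⟩ x z
    constructor
    · rintro ⟨y, h₃, h₄⟩
      refine ⟨y₀⁻¹ * y, (h' _ _ h₁ _ _).1 ?_, (h _ _ h₂ _ _).1 ?_⟩
      · rwa [mul_inv_cancel_left]
      · rwa [mul_inv_cancel_left]
    · rintro ⟨y, h₃, h₄⟩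
      exact ⟨y₀ * y, (h' _ _ h₁ _ _).2 h₃, (h _ _ h₂ _ _).2 h₄⟩
  | inv φ _ h =>
    obtain ⟨ψ, hψ, h⟩ := h
    exact ⟨_, .inv ψ hψ, fun x₀ y₀ h₀ x y => h y₀ x₀ h₀ y x⟩

theorem memI.rimg_leftCoset {φ : Set (G × G)} (hφ : memI σ φ) (g : G) (C : Subgroup G) :
    rimg φ (g • (C : Set G)) = ∅ ∨
      ∃ (ψ : Set (G × G)) (y : G), memIe σ ψ ∧ rimg φ (g • (C : Set G)) = y • rimg ψ (C : Set G) := by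
  rcases Set.eq_empty_or_nonempty (rimg φ (g • (C : Set G))) with h | ⟨y₀, x₀, hx₀, h₀⟩
  · exact Or.inl h
  obtain ⟨ψ, hψ, h⟩ := hφ.exists_memIe
  refine Or.inr ⟨ψ, y₀, hψ, ?_⟩
  rw [mem_leftCoset_iff] at hx₀
  ext y
  rw [Set.mem_smul_set_iff_inv_smul_mem, smul_eq_mul]
  constructor
  · rintro ⟨x, hx, hxy⟩
    rw [mem_leftCoset_iff] at hx
    refine ⟨x₀⁻¹ * x, ?_, (h _ _ h₀ _ _).1 ?_⟩
    · have := C.mul_mem (C.inv_mem hx₀) hx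
      simpa [mul_assoc] using this
    · rwa [mul_inv_cancel_left, mul_inv_cancel_left]
  · rintro ⟨x, hx, hxy⟩
    refine ⟨x₀ * x, ?_, ?_⟩
    · rw [mem_leftCoset_iff, ← mul_assoc]
      exact C.mul_mem hx₀ hx
    · have := (h _ _ h₀ _ _).2 hxy
      rwa [mul_inv_cancel_left] at this

end Constructible

section Cosets

variable {S G : Type*} [Monoid S] [Group G] {σ : S →* Monoid.End G}

variable (σ) in
theorem empty_mem_eCoset : (∅ : Set G) ∈ ECoset σ := Or.inl rfl

theorem IsConstructible.smul_mem_eCoset {C : Subgroup G} (hC : IsConstructible σ C) (g : G) :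
    g • (C : Set G) ∈ ECoset σ :=
  Or.inr ⟨g, C, hC, rfl⟩

theorem IsConstructible.mem_eCoset {C : Subgroup G} (hC : IsConstructible σ C) :
    (C : Set G) ∈ ECoset σ := by
  simpa using hC.smul_mem_eCoset 1

variable (σ) in
theorem univ_mem_eCoset : (Set.univ : Set G) ∈ ECoset σ :=
  (IsConstructible.top (σ := σ)).mem_eCoset

theorem smul_subgroup_eq_of_mem {C : Subgroup G} {g x : G} (hx : x ∈ g • (C : Set G)) :
    g • (C : Set G) = x • (C : Set G) :=
  (leftCoset_eq_iff C).2 ((mem_leftCoset_iff g).1 hx)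

theorem inter_mem_eCoset (hinj : ∀ s : S, Function.Injective (σ s)) {E F : Set G}
    (hE : E ∈ ECoset σ) (hF : F ∈ ECoset σ) : E ∩ F ∈ ECoset σ := by
  rcases Set.eq_empty_or_nonempty (E ∩ F) with h | ⟨x, hxE, hxF⟩
  · exact Or.inl h
  rcases hE with rfl | ⟨g, C, hC, rfl⟩
  · exact hxE.elim
  rcases hF with rfl | ⟨k, D, hD, rfl⟩
  · exact hxF.elim
  refine Or.inr ⟨x, C ⊓ D, hC.inf hinj hD, ?_⟩
  rw [smul_subgroup_eq_of_mem hxE, smul_subgroup_eq_of_mem hxF, ← Set.smul_set_inter]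
  rfl

theorem memI.rimg_mem_eCoset {φ : Set (G × G)} (hφ : memI σ φ) {E : Set G}
    (hE : E ∈ ECoset σ) : rimg φ E ∈ ECoset σ := by
  rcases hE with rfl | ⟨g, C, hC, rfl⟩
  · exact Or.inl (preimRel_empty (rinv φ))
  rcases hφ.rimg_leftCoset g C with h | ⟨ψ, y, hψ, h⟩
  · exact Or.inl h
  obtain ⟨B, hB, hBC⟩ := hψ.exists_constructible_rimg hC
  rw [h, ← hBC]
  exact hB.smul_mem_eCoset y

theorem memI.preimRel_mem_eCoset {φ : Set (G × G)} (hφ : memI σ φ) {E : Set G}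
    (hE : E ∈ ECoset σ) : preimRel φ E ∈ ECoset σ :=
  memI.rimg_mem_eCoset (.inv φ hφ) hE

theorem exists_eCoset_disjoint (hinj : ∀ s : S, Function.Injective (σ s)) {E : Set G}
    (hE : E ∈ ECoset σ) {x : G} (hx : x ∈ E) (s : Finset (Set G))
    (hs : ∀ F ∈ s, F ∈ ECoset σ) (hxs : ∀ F ∈ s, x ∉ F) :
    ∃ E' ∈ ECoset σ, x ∈ E' ∧ E' ⊆ E ∧ ∀ F ∈ s, E' ∩ F = ∅ := by
  classical
  induction s using Finset.induction_on with
  | empty => exact ⟨E, hE, hx, subset_rfl, by simp⟩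
  | insert F s _ ih =>
    simp only [Finset.mem_insert, forall_eq_or_imp] at hs hxs
    obtain ⟨E', hE', hxE', hsub, hdisj⟩ := ih hs.2 hxs.2
    rcases hs.1 with rfl | ⟨g, C, hC, rfl⟩
    · refine ⟨E', hE', hxE', hsub, ?_⟩
      simpa using hdisj
    refine ⟨E' ∩ x • (C : Set G), inter_mem_eCoset hinj hE' (hC.smul_mem_eCoset x),
      ⟨hxE', mem_own_leftCoset C.toSubmonoid x⟩, Set.inter_subset_left.trans hsub, ?_⟩
    simp only [Finset.mem_insert, forall_eq_or_imp]
    constructor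
    · refine Set.eq_empty_of_forall_notMem ?_
      rintro z ⟨⟨-, hz⟩, hz'⟩
      apply hxs.1
      rw [smul_subgroup_eq_of_mem hz', ← smul_subgroup_eq_of_mem hz]
      exact mem_own_leftCoset C.toSubmonoid x
    · intro F hF
      refine Set.subset_eq_empty ?_ (hdisj F hF)
      exact Set.inter_subset_inter_left F Set.inter_subset_left

end Cosets

section IndicatorChar

variable {G : Type*}

open Classical in
/-- The indicator function of a family of sets. -/
noncomputable def indicatorChar (𝓕 : Set (Set G)) : Set G → Bool :=
  fun E => decide (E ∈ 𝓕)

theorem indicatorChar_eq_true {𝓕 : Set (Set G)} {E : Set G} :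
    indicatorChar 𝓕 E = true ↔ E ∈ 𝓕 := by
  simp [indicatorChar]

theorem charFilter_indicatorChar (𝓕 : Set (Set G)) : charFilter (indicatorChar 𝓕) = 𝓕 := by
  ext E
  exact indicatorChar_eq_true

end IndicatorChar

section Characters

variable {S G : Type*} [Monoid S] [Group G] {σ : S →* Monoid.End G}

theorem IsChar.mem_eCoset {χ : Set G → Bool} (hχ : IsChar σ χ) {E : Set G} (hE : χ E = true) :
    E ∈ ECoset σ := by
  by_contra h
  rw [hχ.2.2.2 E h] at hE
  exact Bool.noConfusion hE

theorem IsChar.mono {χ : Set G → Bool} (hχ : IsChar σ χ) {E F : Set G} (hE : χ E = true)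
    (hF : F ∈ ECoset σ) (h : E ⊆ F) : χ F = true := by
  have := hχ.2.2.1 E F (hχ.mem_eCoset hE) hF
  rw [Set.inter_eq_left.2 h, hE] at this
  simpa using this.symm

theorem IsChar.inter {χ : Set G → Bool} (hχ : IsChar σ χ) {E F : Set G} (hE : χ E = true)
    (hF : χ F = true) : χ (E ∩ F) = true := by
  rw [hχ.2.2.1 E F (hχ.mem_eCoset hE) (hχ.mem_eCoset hF), hE, hF]
  rfl

theorem IsChar.nonempty {χ : Set G → Bool} (hχ : IsChar σ χ) {E : Set G} (hE : χ E = true) :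
    E.Nonempty := by
  rw [Set.nonempty_iff_ne_empty]
  rintro rfl
  rw [hχ.1] at hE
  exact Bool.noConfusion hE

theorem isChar_indicatorChar {𝓕 : Set (Set G)} (hempty : ∅ ∉ 𝓕) (huniv : Set.univ ∈ 𝓕)
    (hsub : 𝓕 ⊆ ECoset σ)
    (hinter : ∀ E ∈ ECoset σ, ∀ F ∈ ECoset σ, E ∩ F ∈ 𝓕 ↔ E ∈ 𝓕 ∧ F ∈ 𝓕) :
    IsChar σ (indicatorChar 𝓕) := by
  refine ⟨?_, indicatorChar_eq_true.2 huniv, fun E F hE hF => ?_, fun E hE => ?_⟩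
  · simpa [indicatorChar] using hempty
  · rw [Bool.eq_iff_iff, Bool.and_eq_true, indicatorChar_eq_true, indicatorChar_eq_true,
      indicatorChar_eq_true]
    exact hinter E hE F hF
  · rw [← Bool.not_eq_true, indicatorChar_eq_true]
    exact fun h => hE (hsub h)

theorem isChar_principal (hinj : ∀ s : S, Function.Injective (σ s)) {E : Set G}
    (hne : E.Nonempty) : IsChar σ (indicatorChar {F | F ∈ ECoset σ ∧ E ⊆ F}) := by
  refine isChar_indicatorChar ?_ ⟨univ_mem_eCoset σ, Set.subset_univ E⟩ (fun F hF => hF.1) ?_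
  · rintro ⟨-, h⟩
    exact hne.ne_empty (Set.subset_empty_iff.1 h)
  · intro F hF F' hF'
    simp only [Set.mem_ofPred_eq, Set.subset_inter_iff, hF, hF', inter_mem_eCoset hinj hF hF',
      true_and]

theorem exists_isMaxChar (hinj : ∀ s : S, Function.Injective (σ s)) {E : Set G}
    (hE : E ∈ ECoset σ) (hne : E.Nonempty) : ∃ χ, IsMaxChar σ χ ∧ χ E = true := by
  have hchain : ∀ c ⊆ {𝓕 | ∃ χ, IsChar σ χ ∧ charFilter χ = 𝓕}, IsChain (· ⊆ ·) c →
      c.Nonempty → ∃ ub ∈ {𝓕 | ∃ χ, IsChar σ χ ∧ charFilter χ = 𝓕}, ∀ s ∈ c, s ⊆ ub := by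
    intro c hc hchain hcne
    refine ⟨⋃₀ c, ⟨indicatorChar (⋃₀ c), ?_, charFilter_indicatorChar _⟩,
      fun s hs => Set.subset_sUnion_of_mem hs⟩
    refine isChar_indicatorChar ?_ ?_ ?_ ?_
    · rintro ⟨𝓕, h𝓕, h⟩
      obtain ⟨χ, hχ, rfl⟩ := hc h𝓕
      exact Set.not_nonempty_empty (hχ.nonempty h)
    · obtain ⟨𝓕, h𝓕⟩ := hcne
      obtain ⟨χ, hχ, rfl⟩ := hc h𝓕
      exact ⟨_, h𝓕, hχ.2.1⟩
    · rintro F ⟨𝓕, h𝓕, h⟩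
      obtain ⟨χ, hχ, rfl⟩ := hc h𝓕
      exact hχ.mem_eCoset h
    · intro F hF F' hF'
      constructor
      · rintro ⟨𝓕, h𝓕, h⟩
        obtain ⟨χ, hχ, rfl⟩ := hc h𝓕
        exact ⟨⟨_, h𝓕, hχ.mono h hF Set.inter_subset_left⟩,
          ⟨_, h𝓕, hχ.mono h hF' Set.inter_subset_right⟩⟩
      · rintro ⟨⟨𝓕, h𝓕, h⟩, 𝓕', h𝓕', h'⟩
        rcases hchain.total h𝓕 h𝓕' with hle | hle
        · obtain ⟨χ, hχ, rfl⟩ := hc h𝓕'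
          exact ⟨_, h𝓕', hχ.inter (hle h) h'⟩
        · obtain ⟨χ, hχ, rfl⟩ := hc h𝓕
          exact ⟨_, h𝓕, hχ.inter h (hle h')⟩
  obtain ⟨𝓜, hE𝓜, ⟨χ, hχ, rfl⟩, hmax⟩ := zorn_subset_nonempty
    {𝓕 : Set (Set G) | ∃ χ, IsChar σ χ ∧ charFilter χ = 𝓕} hchain _
    ⟨_, isChar_principal hinj hne, rfl⟩
  refine ⟨χ, ⟨hχ, fun ω hω h => (hmax ⟨ω, hω, rfl⟩ h).antisymm h⟩, hE𝓜 ?_⟩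
  exact indicatorChar_eq_true.2 ⟨hE, subset_rfl⟩

theorem IsMaxChar.exists_disjoint (hinj : ∀ s : S, Function.Injective (σ s)) {χ : Set G → Bool}
    (hχ : IsMaxChar σ χ) {F : Set G} (hF : F ∈ ECoset σ) (h : χ F ≠ true) :
    ∃ E, χ E = true ∧ E ∩ F = ∅ := by
  by_contra! hcon
  have hω : IsChar σ (indicatorChar {E' | E' ∈ ECoset σ ∧ ∃ E, χ E = true ∧ E ∩ F ⊆ E'}) := by
    refine isChar_indicatorChar ?_ ?_ (fun E hE => hE.1) ?_
    · rintro ⟨-, E, hE, hEF⟩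
      exact (hcon E hE).ne_empty (Set.subset_empty_iff.1 hEF)
    · exact ⟨univ_mem_eCoset σ, _, hχ.1.2.1, Set.subset_univ _⟩
    · intro A hA B hB
      constructor
      · rintro ⟨-, E, hE, hEF⟩
        exact ⟨⟨hA, E, hE, hEF.trans Set.inter_subset_left⟩,
          ⟨hB, E, hE, hEF.trans Set.inter_subset_right⟩⟩
      · rintro ⟨⟨-, E, hE, hEF⟩, -, E', hE', hEF'⟩
        refine ⟨inter_mem_eCoset hinj hA hB, _, hχ.1.inter hE hE', ?_⟩
        exact fun x hx => ⟨hEF ⟨hx.1.1, hx.2⟩, hEF' ⟨hx.1.2, hx.2⟩⟩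
  have heq := hχ.2 _ hω (by
    intro E hE
    rw [charFilter_indicatorChar]
    exact ⟨hχ.1.mem_eCoset hE, E, hE, Set.inter_subset_left⟩)
  refine h ?_
  change F ∈ charFilter χ
  rw [← heq, charFilter_indicatorChar]
  exact ⟨hF, _, hχ.1.2.1, Set.inter_subset_right⟩

/-- A character is tight if it is `1` on some member of each finite cover by constructible cosets
of a set on which it is `1`. -/
def IsTightChar (σ : S →* Monoid.End G) (χ : Set G → Bool) : Prop :=
  IsChar σ χ ∧ ∀ E, χ E = true → ∀ s : Finset (Set G), (∀ F ∈ s, F ∈ ECoset σ) →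
    E ⊆ ⋃ F ∈ s, F → ∃ F ∈ s, χ F = true

theorem IsMaxChar.isTightChar (hinj : ∀ s : S, Function.Injective (σ s)) {χ : Set G → Bool}
    (hχ : IsMaxChar σ χ) : IsTightChar σ χ := by
  classical
  refine ⟨hχ.1, fun E hE s hs hcov => ?_⟩
  by_contra! hcon
  have key : ∀ t ⊆ s, ∃ E', χ E' = true ∧ ∀ F ∈ t, E' ∩ F = ∅ := by
    intro t
    induction t using Finset.induction_on with
    | empty => exact fun _ => ⟨E, hE, by simp⟩
    | insert F t _ ih =>
      intro ht
      obtain ⟨E₁, hE₁, h₁⟩ := ih ((Finset.subset_insert F t).trans ht)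
      have hFs : F ∈ s := ht (Finset.mem_insert_self F t)
      obtain ⟨E₂, hE₂, h₂⟩ := hχ.exists_disjoint hinj (hs F hFs) (hcon F hFs)
      refine ⟨E₁ ∩ E₂, hχ.1.inter hE₁ hE₂, ?_⟩
      simp only [Finset.mem_insert, forall_eq_or_imp]
      exact ⟨Set.subset_eq_empty (Set.inter_subset_inter_left F Set.inter_subset_right) h₂,
        fun F' hF' => Set.subset_eq_empty
          (Set.inter_subset_inter_left F' Set.inter_subset_left) (h₁ F' hF')⟩
  obtain ⟨E', hE', hdisj⟩ := key s subset_rfl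
  obtain ⟨x, hxE, hxE'⟩ := hχ.1.nonempty (hχ.1.inter hE hE')
  obtain ⟨F, hF, hxF⟩ := Set.mem_iUnion₂.1 (hcov hxE)
  exact (Set.eq_empty_iff_forall_notMem.1 (hdisj F hF)) x ⟨hxE', hxF⟩

theorem mem_closure_bool_iff {ι : Type*} {A : Set (ι → Bool)} {χ : ι → Bool} :
    χ ∈ closure A ↔ ∀ s : Finset ι, ∃ ω ∈ A, ∀ i ∈ s, ω i = χ i := by
  rw [mem_closure_iff]
  constructor
  · intro h s
    obtain ⟨ω, hω, hA⟩ := h {ω | ∀ i ∈ s, ω i = χ i} (by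
      rw [show {ω : ι → Bool | ∀ i ∈ s, ω i = χ i} = (s : Set ι).pi fun i => {χ i} by
        ext ω; simp [Set.mem_pi]]
      exact isOpen_set_pi s.finite_toSet fun i _ => isOpen_discrete _) fun i _ => rfl
    exact ⟨ω, hA, hω⟩
  · intro h o ho hχ
    obtain ⟨s, u, hu, hsub⟩ := isOpen_pi_iff.1 ho χ hχ
    obtain ⟨ω, hω, hs⟩ := h s
    refine ⟨ω, hsub fun i hi => ?_, hω⟩
    rw [hs i hi]
    exact (hu i hi).2

theorem isClosed_setOf_isTightChar :
    IsClosed {χ : Set G → Bool | IsTightChar σ χ} := by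
  classical
  refine isClosed_of_closure_subset fun χ hχ => ?_
  rw [mem_closure_bool_iff] at hχ
  refine ⟨⟨?_, ?_, fun E F hE hF => ?_, fun E hE => ?_⟩, fun E hE s hs hcov => ?_⟩
  · obtain ⟨ω, hω, h⟩ := hχ {∅}
    rw [← h ∅ (by simp), hω.1.1]
  · obtain ⟨ω, hω, h⟩ := hχ {Set.univ}
    rw [← h Set.univ (by simp), hω.1.2.1]
  · obtain ⟨ω, hω, h⟩ := hχ {E ∩ F, E, F}
    rw [← h (E ∩ F) (by simp), ← h E (by simp), ← h F (by simp), hω.1.2.2.1 E F hE hF]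
  · obtain ⟨ω, hω, h⟩ := hχ {E}
    rw [← h E (by simp), hω.1.2.2.2 E hE]
  · obtain ⟨ω, hω, h⟩ := hχ (insert E s)
    rw [← h E (by simp)] at hE
    obtain ⟨F, hF, hωF⟩ := hω.2 E hE s hs hcov
    exact ⟨F, hF, by rw [← h F (by simp [hF]), hωF]⟩

theorem IsTightChar.mem_closure (hinj : ∀ s : S, Function.Injective (σ s)) {χ : Set G → Bool}
    (hχ : IsTightChar σ χ) : χ ∈ closure {χ : Set G → Bool | IsMaxChar σ χ} := by
  classical
  rw [mem_closure_bool_iff]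
  intro s
  obtain ⟨E, hE, hEs⟩ : ∃ E, χ E = true ∧ ∀ F ∈ s, χ F = true → E ⊆ F := by
    induction s using Finset.induction_on with
    | empty => exact ⟨_, hχ.1.2.1, by simp⟩
    | insert F s _ ih =>
      obtain ⟨E, hE, h⟩ := ih
      simp only [Finset.mem_insert, forall_eq_or_imp]
      by_cases hF : χ F = true
      · exact ⟨E ∩ F, hχ.1.inter hE hF, fun _ => Set.inter_subset_right,
          fun F' hF' h' => Set.inter_subset_left.trans (h F' hF' h')⟩
      · exact ⟨E, hE, fun h' => (hF h').elim, h⟩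
  let t : Finset (Set G) := {F ∈ s | F ∈ ECoset σ ∧ χ F ≠ true}
  have ht : ∀ F ∈ t, F ∈ ECoset σ ∧ χ F ≠ true := fun F hF => (Finset.mem_filter.1 hF).2
  have hncov : ¬ E ⊆ ⋃ F ∈ t, F := by
    intro hcov
    obtain ⟨F, hF, h⟩ := hχ.2 E hE t (fun F hF => (ht F hF).1) hcov
    exact (ht F hF).2 h
  obtain ⟨x, hxE, hxt⟩ := Set.not_subset.1 hncov
  simp only [Set.mem_iUnion, not_exists] at hxt
  obtain ⟨E', hE', hxE', hsub, hdisj⟩ := exists_eCoset_disjoint hinj (hχ.1.mem_eCoset hE) hxE t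
    (fun F hF => (ht F hF).1) hxt
  obtain ⟨ω, hω, hωE'⟩ := exists_isMaxChar hinj hE' ⟨x, hxE'⟩
  refine ⟨ω, hω, fun F hF => ?_⟩
  by_cases hFE : F ∈ ECoset σ
  · by_cases hχF : χ F = true
    · rw [hχF]
      exact hω.1.mono hωE' hFE (hsub.trans (hEs F hF hχF))
    · rw [Bool.eq_iff_iff, iff_false_right hχF]
      intro hωF
      refine (hω.1.nonempty (hω.1.inter hωE' hωF)).ne_empty (hdisj F ?_)
      exact Finset.mem_filter.2 ⟨hF, hFE, hχF⟩
  · rw [hω.1.2.2.2 F hFE, hχ.1.2.2.2 F hFE]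

/-- The boundary consists of the tight characters. -/
theorem mem_boundary_iff (hinj : ∀ s : S, Function.Injective (σ s)) {χ : Set G → Bool} :
    χ ∈ Boundary σ ↔ IsTightChar σ χ := by
  constructor
  · rintro ⟨-, h⟩
    exact closure_minimal (fun ω hω => hω.isTightChar hinj) isClosed_setOf_isTightChar h
  · exact fun h => ⟨h.1, h.mem_closure hinj⟩

theorem isCompact_boundary (hinj : ∀ s : S, Function.Injective (σ s)) :
    IsCompact (Boundary σ) := by
  have h : Boundary σ = {χ | IsTightChar σ χ} := Set.ext fun χ => mem_boundary_iff hinj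
  rw [h]
  exact isClosed_setOf_isTightChar.isCompact

theorem IsMaxChar.mem_boundary {χ : Set G → Bool} (hχ : IsMaxChar σ χ) : χ ∈ Boundary σ :=
  ⟨hχ.1, subset_closure hχ⟩

theorem charAct_apply {φ : Set (G × G)} {χ : Set G → Bool} {E : Set G} (hE : E ∈ ECoset σ) :
    charAct σ φ χ E = χ (preimRel φ E) :=
  if_pos hE

theorem charAct_eq_true_iff {φ : Set (G × G)} {χ : Set G → Bool} {E : Set G} :
    charAct σ φ χ E = true ↔ E ∈ ECoset σ ∧ χ (preimRel φ E) = true := by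
  by_cases hE : E ∈ ECoset σ <;> simp [charAct, hE]

theorem IsTightChar.charAct (hinj : ∀ s : S, Function.Injective (σ s)) {χ : Set G → Bool}
    (hχ : IsTightChar σ χ) {φ : Set (G × G)} (hφ : memI σ φ) (hdom : χ (rdom φ) = true) :
    IsTightChar σ (charAct σ φ χ) := by
  classical
  refine ⟨⟨?_, ?_, fun E F hE hF => ?_, fun E hE => if_neg hE⟩, fun E hE s hs hcov => ?_⟩
  · rw [charAct_apply (empty_mem_eCoset σ), preimRel_empty, hχ.1.1]
  · rw [charAct_apply (univ_mem_eCoset σ), preimRel_univ, hdom]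
  · rw [charAct_apply (inter_mem_eCoset hinj hE hF), charAct_apply hE, charAct_apply hF,
      (hφ.isPartialBij hinj).preimRel_inter,
      hχ.1.2.2.1 _ _ (hφ.preimRel_mem_eCoset hE) (hφ.preimRel_mem_eCoset hF)]
  · rw [charAct_eq_true_iff] at hE
    obtain ⟨F', hF', h⟩ := hχ.2 _ hE.2 (s.image (preimRel φ)) (by
      simp only [Finset.mem_image, forall_exists_index, and_imp]
      rintro _ F hF rfl
      exact hφ.preimRel_mem_eCoset (hs F hF)) (by
      rintro x ⟨y, hy, hxy⟩
      obtain ⟨F, hF, hyF⟩ := Set.mem_iUnion₂.1 (hcov hy)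
      exact Set.mem_iUnion₂.2 ⟨_, Finset.mem_image_of_mem _ hF, y, hyF, hxy⟩)
    obtain ⟨F, hF, rfl⟩ := Finset.mem_image.1 hF'
    exact ⟨F, hF, charAct_eq_true_iff.2 ⟨hs F hF, h⟩⟩

end Characters

section Minimality

variable {S G : Type*} [Monoid S] [Group G] {σ : S →* Monoid.End G}

/-- Finitely many images of `D` under elements of `I` cover `G`. -/
def HasFiniteCover (σ : S →* Monoid.End G) (D : Subgroup G) : Prop :=
  ∃ (n : ℕ) (φ : Fin n → Set (G × G)), (∀ i, memI σ (φ i)) ∧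
    Set.univ = ⋃ i, rimg (φ i) (rdom (φ i) ∩ (D : Set G))

/-- Some element of `I^e` maps a constructible subgroup of `D` onto a finite index subgroup. -/
def HasFiniteIndexImage (σ : S →* Monoid.End G) (D : Subgroup G) : Prop :=
  ∃ (φ : Set (G × G)) (D' : Subgroup G), memIe σ φ ∧ IsConstructible σ D' ∧
    (D' : Set G) ⊆ (D : Set G) ∩ rdom φ ∧
    ∃ B : Subgroup G, (B : Set G) = rimg φ (D' : Set G) ∧ B.index ≠ 0

theorem HasFiniteIndexImage.hasFiniteCover {D : Subgroup G} (h : HasFiniteIndexImage σ D) :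
    HasFiniteCover σ D := by
  obtain ⟨φ, D', hφ, -, hD', B, hB, hind⟩ := h
  have : B.FiniteIndex := ⟨hind⟩
  have : Finite (G ⧸ B) := inferInstance
  obtain ⟨n, ⟨e⟩⟩ := Finite.exists_equiv_fin (G ⧸ B)
  refine ⟨n, fun i => rcomp (grph fun h => (e.symm i).out * h) φ,
    fun i => .comp _ _ (memI_grph_mul_left σ _) hφ.memI, Eq.symm (Set.eq_univ_of_forall fun x => ?_)⟩
  refine Set.mem_iUnion.2 ⟨e (x : G ⧸ B), ?_⟩
  rw [rimg_rdom_inter, rimg_rcomp, rimg_grph, Equiv.symm_apply_apply]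
  refine ⟨(x : G ⧸ B).out⁻¹ * x, ?_, mul_inv_cancel_left _ _⟩
  have hx : (x : G ⧸ B).out⁻¹ * x ∈ (B : Set G) :=
    QuotientGroup.eq.1 (QuotientGroup.out_eq' (x : G ⧸ B))
  rw [hB] at hx
  exact rimg_mono φ (fun y hy => (hD' hy).1) hx

theorem HasFiniteCover.hasFiniteIndexImage (hinj : ∀ s : S, Function.Injective (σ s))
    {D : Subgroup G} (hD : IsConstructible σ D) (h : HasFiniteCover σ D) :
    HasFiniteIndexImage σ D := by
  classical
  obtain ⟨n, φ, hφ, hcov⟩ := h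
  have key : ∀ i, ∃ (ψ : Set (G × G)) (y : G) (B : Subgroup G), (rimg (φ i) D).Nonempty →
      memIe σ ψ ∧ IsConstructible σ B ∧ (B : Set G) = rimg ψ D ∧
        rimg (φ i) D = y • (B : Set G) := by
    intro i
    have h := (hφ i).rimg_leftCoset 1 D
    rw [one_smul] at h
    rcases h with h | ⟨ψ, y, hψ, h⟩
    · exact ⟨∅, 1, ⊤, fun hne => (hne.ne_empty h).elim⟩
    · obtain ⟨B, hB, hBD⟩ := hψ.exists_constructible_rimg hD
      exact ⟨ψ, y, B, fun _ => ⟨hψ, hB, hBD, by rw [h, hBD]⟩⟩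
  choose ψ y B hB using key
  have hcov' : ⋃ i ∈ Finset.univ.filter fun i => (rimg (φ i) (D : Set G)).Nonempty,
      y i • (B i : Set G) = Set.univ := by
    refine Set.eq_univ_of_forall fun x => ?_
    have hx : x ∈ ⋃ i, rimg (φ i) (rdom (φ i) ∩ (D : Set G)) := hcov ▸ Set.mem_univ x
    obtain ⟨i, hi⟩ := Set.mem_iUnion.1 hx
    rw [rimg_rdom_inter] at hi
    refine Set.mem_iUnion₂.2 ⟨i, by simpa using ⟨x, hi⟩, ?_⟩
    rwa [← (hB i ⟨x, hi⟩).2.2.2]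
  obtain ⟨i, hi, hfin⟩ := Subgroup.exists_finiteIndex_of_leftCoset_cover hcov'
  obtain ⟨hψ, hBc, hBD, -⟩ := hB i (Finset.mem_filter.1 hi).2
  have hbij := hψ.isPartialBij hinj
  obtain ⟨D', hD', hD'B⟩ := hψ.exists_constructible_preimRel hBc
  rw [hBD, hbij.preimRel_rimg] at hD'B
  exact ⟨ψ i, D', hψ, hD', hD'B.subset, B i,
    by rw [hBD, hD'B, Set.inter_comm, rimg_rdom_inter], hfin.index_ne_zero⟩

theorem HasFiniteIndexImage.exists_le (hinj : ∀ s : S, Function.Injective (σ s))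
    {C D : Subgroup G} (hC : IsConstructible σ C) (h : HasFiniteIndexImage σ D) :
    ∃ (φ : Set (G × G)) (D' : Subgroup G), memIe σ φ ∧ IsConstructible σ D' ∧
      (D' : Set G) ⊆ (D : Set G) ∩ rdom φ ∧
      ∃ B : Subgroup G, (B : Set G) = rimg φ (D' : Set G) ∧ B ≤ C ∧ B.relIndex C ≠ 0 := by
  obtain ⟨φ, D', hφ, hD', hsub, B, hB, hind⟩ := h
  have hbij := hφ.isPartialBij hinj
  obtain ⟨A, hA, hAB⟩ := hφ.exists_constructible_rimg hD'
  obtain rfl : A = B := SetLike.coe_injective (hAB.trans hB.symm)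
  obtain ⟨D'', hD'', hD''C⟩ := hφ.exists_constructible_preimRel (hA.inf hinj hC)
  have hD''D' : (D'' : Set G) ⊆ D' := by
    rw [hD''C, Subgroup.coe_inf, hbij.preimRel_inter, hB, hbij.preimRel_rimg]
    exact Set.inter_subset_left.trans Set.inter_subset_left
  refine ⟨φ, D'', hφ, hD'', hD''D'.trans hsub, A ⊓ C, ?_, inf_le_right, ?_⟩
  · rw [hD''C, hbij.rimg_preimRel, eq_comm, Set.inter_eq_left, Subgroup.coe_inf, hB]
    refine Set.inter_subset_left.trans ?_
    rintro y ⟨x, -, hxy⟩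
    exact ⟨x, hxy⟩
  · rw [Subgroup.inf_relIndex_right]
    rw [← Subgroup.relIndex_top_right] at hind
    exact fun h => hind (Subgroup.relIndex_eq_zero_of_le_right le_top h)

variable (σ) in
theorem finHerFilter_isConstructible (hinj : ∀ s : S, Function.Injective (σ s)) :
    FinHerFilter σ {C | IsConstructible σ C} :=
  ⟨fun _ h => h, .top, fun _ hC _ hD => IsConstructible.inf hinj hC hD, fun _ _ _ hD _ => hD,
    fun _ _ _ hD _ _ => hD⟩

variable (σ) in
theorem finHerFilter_finiteIndex (hinj : ∀ s : S, Function.Injective (σ s)) :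
    FinHerFilter σ {C | IsConstructible σ C ∧ C.index ≠ 0} := by
  refine ⟨fun _ h => h.1, ⟨.top, by simp⟩,
    fun C hC D hD => ⟨hC.1.inf hinj hD.1, Subgroup.index_inf_ne_zero hC.2 hD.2⟩,
    fun C hC D hD hle => ⟨hD, fun h => hC.2 ?_⟩, fun C hC D hD hle hind => ⟨hD, ?_⟩⟩
  · exact Nat.eq_zero_of_zero_dvd (h ▸ Subgroup.index_dvd_of_le hle)
  · rw [← Subgroup.relIndex_mul_index hle]
    exact mul_ne_zero hind hC.2

theorem exists_isSmallestFHF (hinj : ∀ s : S, Function.Injective (σ s)) {A : Set (Subgroup G)}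
    (hA : ∀ C ∈ A, IsConstructible σ C) : ∃ 𝔊, IsSmallestFHF σ A 𝔊 := by
  refine ⟨{C | ∀ 𝔊, FinHerFilter σ 𝔊 → A ⊆ 𝔊 → C ∈ 𝔊}, ⟨?_, ?_, ?_, ?_, ?_⟩, ?_, ?_⟩
  · exact fun C hC => hC _ (finHerFilter_isConstructible σ hinj) hA
  · exact fun 𝔊 h _ => h.2.1
  · exact fun C hC D hD 𝔊 h hA => h.2.2.1 C (hC 𝔊 h hA) D (hD 𝔊 h hA)
  · exact fun C hC D hD hle 𝔊 h hA => h.2.2.2.1 C (hC 𝔊 h hA) D hD hle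
  · exact fun C hC D hD hle hind 𝔊 h hA => h.2.2.2.2 C (hC 𝔊 h hA) D hD hle hind
  · exact fun C hC 𝔊 _ hA => hA hC
  · exact fun 𝔊 h hA C hC => hC 𝔊 h hA

theorem filterActGens_isConstructible {φ : Set (G × G)} (hφ : memIe σ φ)
    {𝔉 : Set (Subgroup G)} (h𝔉 : FinHerFilter σ 𝔉) :
    ∀ B ∈ filterActGens σ φ 𝔉, IsConstructible σ B := by
  rintro B ⟨D, hD, -, hB⟩
  obtain ⟨A, hA, hAD⟩ := hφ.exists_constructible_rimg (h𝔉.1 D hD)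
  obtain rfl : A = B := SetLike.coe_injective (hAD.trans hB.symm)
  exact hA

/-- The upward closure of the images `φ(C)`, `C ∈ 𝔉`, is finitely hereditary. -/
theorem finHerFilter_upwardClosure (hinj : ∀ s : S, Function.Injective (σ s))
    {φ : Set (G × G)} (hφ : memIe σ φ) {𝔉 : Set (Subgroup G)} (h𝔉 : FinHerFilter σ 𝔉)
    (hdef : ∃ C ∈ 𝔉, (C : Set G) ⊆ rdom φ) :
    FinHerFilter σ {D | IsConstructible σ D ∧
      ∃ C ∈ 𝔉, (C : Set G) ⊆ rdom φ ∧ rimg φ (C : Set G) ⊆ D} := by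
  have hbij := hφ.isPartialBij hinj
  refine ⟨fun D hD => hD.1, ?_, ?_, ?_, ?_⟩
  · obtain ⟨C, hC, hCφ⟩ := hdef
    exact ⟨.top, C, hC, hCφ, Set.subset_univ _⟩
  · rintro D ⟨hD, C, hC, hCφ, hCD⟩ D' ⟨hD', C', hC', hCφ', hCD'⟩
    refine ⟨hD.inf hinj hD', C ⊓ C', h𝔉.2.2.1 C hC C' hC',
      Set.inter_subset_left.trans hCφ, Set.subset_inter ?_ ?_⟩
    · exact (rimg_mono φ Set.inter_subset_left).trans hCD
    · exact (rimg_mono φ Set.inter_subset_right).trans hCD'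
  · rintro D ⟨-, C, hC, hCφ, hCD⟩ D' hD' hle
    exact ⟨hD', C, hC, hCφ, hCD.trans hle⟩
  · rintro D ⟨hD, C, hC, hCφ, hCD⟩ D' hD' hle hind
    obtain ⟨B, hB, hBC⟩ := hφ.exists_constructible_rimg (h𝔉.1 C hC)
    obtain ⟨C', hC', hCB'⟩ := hφ.exists_constructible_preimRel (hB.inf hinj hD')
    have hrimg : rimg φ (C' : Set G) = (B ⊓ D' : Subgroup G) := by
      rw [hCB', hbij.rimg_preimRel, Set.inter_eq_left, Subgroup.coe_inf, hBC]
      refine Set.inter_subset_left.trans ?_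
      rintro y ⟨x, -, hxy⟩
      exact ⟨x, hxy⟩
    have hle' : C' ≤ C := by
      intro x hx
      have hx' : x ∈ (C' : Set G) := hx
      rw [hCB', Subgroup.coe_inf, hbij.preimRel_inter, hBC, hbij.preimRel_rimg] at hx'
      exact hx'.1.1
    refine ⟨hD', C', h𝔉.2.2.2.2 C hC C' hC' hle' ?_,
      fun x hx => hCφ (hle' hx), hrimg.subset.trans Set.inter_subset_right⟩
    rw [← hφ.relIndex_eq hinj hCφ hBC hrimg.symm, Subgroup.inf_relIndex_left]
    intro h
    have hBD : B ≤ D := fun x hx => hCD (hBC.subset hx)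
    exact hind (Subgroup.relIndex_eq_zero_of_le_right hBD h)

theorem forall_hasFiniteIndexImage_iff (hinj : ∀ s : S, Function.Injective (σ s)) :
    (∀ D : Subgroup G, IsConstructible σ D → HasFiniteIndexImage σ D) ↔
      ∀ 𝔽 : Set (Set (Subgroup G)), (∀ 𝔉 ∈ 𝔽, FinHerFilter σ 𝔉) →
        IeInvariant σ 𝔽 → SubsetClosed σ 𝔽 → 𝔽.Nonempty →
        𝔽 = {𝔉 : Set (Subgroup G) | FinHerFilter σ 𝔉} := by
  constructor
  · rintro h 𝔽 h𝔽 hinv hclosed ⟨𝔉, h𝔉⟩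
    refine Set.Subset.antisymm h𝔽 fun 𝔈 h𝔈 => hclosed 𝔈 h𝔈 fun D hD => ?_
    obtain ⟨φ, D', hφ, hD', hsub, B, hB, hind⟩ := h D (h𝔈.1 D hD)
    have hbij := hφ.isPartialBij hinj
    have hφ' : memIe σ (rinv φ) := .inv φ hφ
    obtain ⟨A, hA, hAB⟩ := hφ.exists_constructible_rimg hD'
    obtain rfl : A = B := SetLike.coe_injective (hAB.trans hB.symm)
    have hA𝔉 : A ∈ 𝔉 := (h𝔽 𝔉 h𝔉).2.2.2.2 ⊤ (h𝔽 𝔉 h𝔉).2.1 A hA le_top (by simpa using hind)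
    have hAdom : (A : Set G) ⊆ rdom (rinv φ) := by
      rw [hB]
      rintro y ⟨x, -, hxy⟩
      exact ⟨x, hxy⟩
    obtain ⟨𝔊, h𝔊⟩ := exists_isSmallestFHF hinj
      (filterActGens_isConstructible hφ' (h𝔽 𝔉 h𝔉))
    refine ⟨𝔊, hinv 𝔉 h𝔉 _ hφ' ⟨A, hA𝔉, hAdom⟩ 𝔊 h𝔊, ?_⟩
    refine h𝔊.1.2.2.2.1 D' (h𝔊.2.1 ⟨A, hA𝔉, hAdom, ?_⟩) D (h𝔈.1 D hD) fun x hx => (hsub hx).1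
    rw [rimg_rinv, hB, hbij.preimRel_rimg, eq_comm, Set.inter_eq_left]
    exact fun x hx => (hsub hx).2
  · intro h D hD
    have h𝔽 := h {𝔉 | FinHerFilter σ 𝔉 ∧ ∀ C ∈ 𝔉, HasFiniteIndexImage σ C}
      (fun 𝔉 h𝔉 => h𝔉.1) ?_ ?_ ?_
    · have hmem : {C | IsConstructible σ C} ∈ {𝔉 : Set (Subgroup G) | FinHerFilter σ 𝔉} :=
        finHerFilter_isConstructible σ hinj
      rw [← h𝔽] at hmem
      exact hmem.2 D hD
    · rintro 𝔉 ⟨h𝔉, hfin⟩ φ hφ hdef 𝔊 h𝔊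
      refine ⟨h𝔊.1, fun D hD => ?_⟩
      have hup := h𝔊.2.2 _ (finHerFilter_upwardClosure hinj hφ h𝔉 hdef) (by
        rintro B hB
        refine ⟨filterActGens_isConstructible hφ h𝔉 B hB, ?_⟩
        obtain ⟨C, hC, hCφ, hBC⟩ := hB
        exact ⟨C, hC, hCφ, hBC.superset⟩) hD
      obtain ⟨-, C, hC, hCφ, hCD⟩ := hup
      obtain ⟨ψ, C', hψ, hC', hsub, A, hA, hind⟩ := hfin C hC
      obtain ⟨B, hB, hBC⟩ := hφ.exists_constructible_rimg hC'
      have hpre : preimRel φ (rimg φ (C' : Set G)) = C' := by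
        rw [(hφ.isPartialBij hinj).preimRel_rimg, Set.inter_eq_left]
        exact fun x hx => hCφ (hsub hx).1
      refine ⟨rcomp ψ (rinv φ), B, .comp _ _ hψ (.inv _ hφ), hB, ?_, A, ?_, hind⟩
      · rw [hBC]
        rintro y ⟨x, hx, hxy⟩
        obtain ⟨z, hz⟩ := (hsub hx).2
        exact ⟨hCD ⟨x, (hsub hx).1, hxy⟩, z, x, hxy, hz⟩
      · rw [rimg_rcomp, rimg_rinv, hBC, hpre, hA]
    · exact fun 𝔈 h𝔈 hsub => ⟨h𝔈, fun C hC => by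
        obtain ⟨𝔉, h𝔉, hC𝔉⟩ := hsub C hC
        exact h𝔉.2 C hC𝔉⟩
    · refine ⟨_, finHerFilter_finiteIndex σ hinj, fun C hC => ?_⟩
      refine ⟨_, C, memIe_grph_id σ, hC.1, fun x hx => ⟨hx, x, rfl⟩, C, ?_, hC.2⟩
      rw [rimg_grph, Set.image_id]

theorem IsMaxChar.exists_forall_agree (hinj : ∀ s : S, Function.Injective (σ s))
    {ω : Set G → Bool} (hω : IsMaxChar σ ω) (s : Finset (Set G)) :
    ∃ E, ω E = true ∧ ∀ χ, IsChar σ χ → χ E = true → ∀ F ∈ s, χ F = ω F := by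
  classical
  induction s using Finset.induction_on with
  | empty => exact ⟨_, hω.1.2.1, by simp⟩
  | insert F s _ ih =>
    obtain ⟨E, hE, h⟩ := ih
    obtain ⟨E', hE', h'⟩ : ∃ E', ω E' = true ∧ ∀ χ, IsChar σ χ → χ E' = true → χ F = ω F := by
      by_cases hF : F ∈ ECoset σ
      · by_cases hωF : ω F = true
        · exact ⟨F, hωF, fun χ _ hχF => hχF.trans hωF.symm⟩
        · obtain ⟨E', hE', hdisj⟩ := hω.exists_disjoint hinj hF hωF
          refine ⟨E', hE', fun χ hχ hχE' => ?_⟩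
          rw [Bool.eq_iff_iff, iff_false_right hωF]
          exact fun hχF => (hχ.nonempty (hχ.inter hχE' hχF)).ne_empty hdisj
      · exact ⟨_, hω.1.2.1, fun χ hχ _ => by rw [hχ.2.2.2 F hF, hω.1.2.2.2 F hF]⟩
    refine ⟨E ∩ E', hω.1.inter hE hE', fun χ hχ hχE => ?_⟩
    simp only [Finset.mem_insert, forall_eq_or_imp]
    exact ⟨h' χ hχ (hχ.mono hχE (hω.1.mem_eCoset hE') Set.inter_subset_right),
      h χ hχ (hχ.mono hχE (hω.1.mem_eCoset hE) Set.inter_subset_left)⟩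

theorem boundary_minimal_of_forall_hasFiniteCover (hinj : ∀ s : S, Function.Injective (σ s))
    (h : ∀ D : Subgroup G, IsConstructible σ D → HasFiniteCover σ D)
    {𝔛 : Set (Set G → Bool)} (hsub : 𝔛 ⊆ Boundary σ) (hclosed : closure 𝔛 ∩ Boundary σ ⊆ 𝔛)
    (hinv : IsInvariantSet σ 𝔛) (hne : 𝔛.Nonempty) : 𝔛 = Boundary σ := by
  classical
  obtain ⟨χ, hχ⟩ := hne
  have htight := (mem_boundary_iff hinj).1 (hsub hχ)
  have hmax : {ω | IsMaxChar σ ω} ⊆ closure 𝔛 := by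
    intro ω hω
    rw [mem_closure_bool_iff]
    intro s
    obtain ⟨E, hE, hagree⟩ := IsMaxChar.exists_forall_agree hinj hω s
    rcases hω.1.mem_eCoset hE with rfl | ⟨g, C, hC, rfl⟩
    · exact (Set.not_nonempty_empty (hω.1.nonempty hE)).elim
    obtain ⟨n, φ, hφ, hcov⟩ := h C hC
    simp only [rimg_rdom_inter] at hcov
    obtain ⟨F, hF, hχF⟩ := htight.2 _ htight.1.2.1
      (Finset.univ.image fun i => rimg (φ i) (C : Set G)) (by
        simp only [Finset.mem_image, forall_exists_index, and_imp]
        rintro _ i - rfl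
        exact (hφ i).rimg_mem_eCoset hC.mem_eCoset) (by
        rw [hcov]
        exact Set.iUnion_subset fun i =>
          Set.subset_biUnion_of_mem (u := fun F => F)
            (Finset.mem_coe.2 (Finset.mem_image_of_mem _ (Finset.mem_univ i))))
    obtain ⟨i, -, rfl⟩ := Finset.mem_image.1 hF
    have hψ : memI σ (rcomp (grph fun x => g * x) (rinv (φ i))) :=
      .comp _ _ (memI_grph_mul_left σ g) (.inv _ (hφ i))
    have hpre : preimRel (rcomp (grph fun x => g * x) (rinv (φ i))) (g • (C : Set G)) =
        rimg (φ i) C := by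
      rw [← rimg_rinv, rinv_rcomp, rinv_rinv, rimg_rcomp, rimg_rinv, preimRel_grph]
      congr 1
      ext x
      exact Set.smul_mem_smul_set_iff
    have hdom : χ (rdom (rcomp (grph fun x => g * x) (rinv (φ i)))) = true := by
      refine htight.1.mono hχF ?_ (hpre ▸ preimRel_subset_rdom _ _)
      rw [← preimRel_univ]
      exact hψ.preimRel_mem_eCoset (univ_mem_eCoset σ)
    have hmem := hinv _ hψ χ hχ hdom
    refine ⟨_, hmem, hagree _ (hsub hmem).1 ?_⟩
    rw [charAct_apply (hC.smul_mem_eCoset g), hpre, hχF]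
  refine hsub.antisymm fun ω hω => hclosed ⟨?_, hω⟩
  exact closure_minimal hmax isClosed_closure hω.2

theorem hasFiniteCover_of_boundary_minimal (hinj : ∀ s : S, Function.Injective (σ s))
    (h : ∀ 𝔛 : Set (Set G → Bool), 𝔛 ⊆ Boundary σ → closure 𝔛 ∩ Boundary σ ⊆ 𝔛 →
      IsInvariantSet σ 𝔛 → 𝔛.Nonempty → 𝔛 = Boundary σ)
    {D : Subgroup G} (hD : IsConstructible σ D) : HasFiniteCover σ D := by
  classical
  let 𝔛 : Set (Set G → Bool) :=
    {χ | χ ∈ Boundary σ ∧ ∀ φ, memI σ φ → χ (rimg φ (D : Set G)) ≠ true}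
  have hempty : ¬ 𝔛.Nonempty := by
    intro hne
    have heq := h 𝔛 (fun χ hχ => hχ.1) ?_ ?_ hne
    · obtain ⟨χ, hχ, hχD⟩ := exists_isMaxChar hinj hD.mem_eCoset ⟨1, D.one_mem⟩
      have hmem := hχ.mem_boundary
      rw [← heq] at hmem
      refine hmem.2 _ (memIe_grph_id σ).memI ?_
      rwa [rimg_grph, Set.image_id]
    · rintro χ ⟨hχ, hχb⟩
      refine ⟨hχb, fun φ hφ => ?_⟩
      obtain ⟨ω, hω, hagree⟩ := mem_closure_bool_iff.1 hχ {rimg φ (D : Set G)}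
      rw [← hagree _ (Finset.mem_singleton_self _)]
      exact hω.2 φ hφ
    · rintro ψ hψ χ ⟨hχ, hχD⟩ hdom
      refine ⟨(mem_boundary_iff hinj).2
        (((mem_boundary_iff hinj).1 hχ).charAct hinj hψ hdom), fun φ hφ hcon => ?_⟩
      rw [charAct_eq_true_iff] at hcon
      refine hχD (rcomp (rinv ψ) φ) (.comp _ _ (.inv _ hψ) hφ) ?_
      rw [rimg_rcomp, rimg_rinv, hcon.2]
  obtain ⟨t, ht⟩ := (isCompact_boundary hinj).elim_finite_subcover
    (fun φ : {φ // memI σ φ} => (fun χ : Set G → Bool => χ (rimg φ.1 (D : Set G))) ⁻¹' {true})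
    (fun φ => (isOpen_discrete ({true} : Set Bool)).preimage
      (continuous_apply (rimg φ.1 (D : Set G)))) (by
      intro χ hχ
      by_contra hcon
      refine hempty ⟨χ, hχ, fun φ hφ hφχ => hcon ?_⟩
      exact Set.mem_iUnion.2 ⟨⟨φ, hφ⟩, hφχ⟩)
  refine ⟨t.card, fun i => (t.equivFin.symm i).1.1, fun i => (t.equivFin.symm i).1.2,
    Eq.symm (Set.eq_univ_of_forall fun x => ?_)⟩
  simp only [rimg_rdom_inter]
  by_contra hx
  simp only [Set.mem_iUnion, not_exists] at hx
  obtain ⟨E, hE, hxE, -, hdisj⟩ := exists_eCoset_disjoint hinj (univ_mem_eCoset σ)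
    (Set.mem_univ x) (t.image fun φ => rimg φ.1 (D : Set G)) (by
      simp only [Finset.mem_image, forall_exists_index, and_imp]
      rintro _ φ - rfl
      exact φ.2.rimg_mem_eCoset hD.mem_eCoset) (by
      simp only [Finset.mem_image, forall_exists_index, and_imp]
      rintro _ φ hφ rfl
      simpa using hx (t.equivFin ⟨φ, hφ⟩))
  obtain ⟨χ, hχ, hχE⟩ := exists_isMaxChar hinj hE ⟨x, hxE⟩
  obtain ⟨φ, hφ, hχφ⟩ := Set.mem_iUnion₂.1 (ht hχ.mem_boundary)
  exact (hχ.1.nonempty (hχ.1.inter hχE hχφ)).ne_empty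
    (hdisj _ (Finset.mem_image_of_mem (fun φ : {φ // memI σ φ} => rimg φ.1 (D : Set G)) hφ))

end Minimality

/-- Theorem 4.9 (thm:minimal): for a non-automorphic algebraic action, the
conditions (M0) (minimality of the tight groupoid, i.e. no nonempty proper
closed invariant subsets of `∂Ê`), (M1), (M2), (M3), (M4), (M5) are all
equivalent. -/
theorem minimality_characterizations
    {S G : Type*} [Monoid S] [Group G] [Nontrivial G]
    (σ : S →* Monoid.End G)
    (hinj : ∀ s : S, Function.Injective (σ s))
    (hfaith : Function.Injective σ)
    (hna : ∃ s : S, Set.range (σ s : G → G) ≠ Set.univ) :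
    List.TFAE [
      -- (M0): minimality of 𝒢_σ
      (∀ 𝔛 : Set (Set G → Bool), 𝔛 ⊆ Boundary σ → closure 𝔛 ∩ Boundary σ ⊆ 𝔛 →
        IsInvariantSet σ 𝔛 → 𝔛.Nonempty → 𝔛 = Boundary σ),
      -- (M1)
      (∀ C D : Subgroup G, IsConstructible σ C → IsConstructible σ D →
        ∃ (n : ℕ) (φ : Fin n → Set (G × G)), (∀ i, memI σ (φ i)) ∧
          (C : Set G) ⊆ ⋃ i, rimg (φ i) (rdom (φ i) ∩ (D : Set G))),
      -- (M2)
      (∀ D : Subgroup G, IsConstructible σ D →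
        ∃ (n : ℕ) (φ : Fin n → Set (G × G)), (∀ i, memI σ (φ i)) ∧
          Set.univ = ⋃ i, rimg (φ i) (rdom (φ i) ∩ (D : Set G))),
      -- (M3)
      (∀ C D : Subgroup G, IsConstructible σ C → IsConstructible σ D →
        ∃ (φ : Set (G × G)) (D' : Subgroup G), memIe σ φ ∧ IsConstructible σ D' ∧
          (D' : Set G) ⊆ (D : Set G) ∩ rdom φ ∧
          ∃ B : Subgroup G, (B : Set G) = rimg φ (D' : Set G) ∧ B ≤ C ∧
            B.relIndex C ≠ 0),
      -- (M4)
      (∀ D : Subgroup G, IsConstructible σ D →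
        ∃ (φ : Set (G × G)) (D' : Subgroup G), memIe σ φ ∧ IsConstructible σ D' ∧
          (D' : Set G) ⊆ (D : Set G) ∩ rdom φ ∧
          ∃ B : Subgroup G, (B : Set G) = rimg φ (D' : Set G) ∧ B.index ≠ 0),
      -- (M5)
      (∀ 𝔽 : Set (Set (Subgroup G)), (∀ 𝔉 ∈ 𝔽, FinHerFilter σ 𝔉) →
        IeInvariant σ 𝔽 → SubsetClosed σ 𝔽 → 𝔽.Nonempty →
        𝔽 = {𝔉 : Set (Subgroup G) | FinHerFilter σ 𝔉})] := by
  tfae_have 1 → 3 := fun h D hD => hasFiniteCover_of_boundary_minimal hinj h hD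
  tfae_have 3 → 1 := fun h _ hsub hclosed hinv hne =>
    boundary_minimal_of_forall_hasFiniteCover hinj h hsub hclosed hinv hne
  tfae_have 2 → 3 := by
    intro h D hD
    obtain ⟨n, φ, hφ, hcov⟩ := h ⊤ D .top hD
    exact ⟨n, φ, hφ, (Set.univ_subset_iff.1 hcov).symm⟩
  tfae_have 3 → 2 := by
    intro h C D _ hD
    obtain ⟨n, φ, hφ, hcov⟩ := h D hD
    exact ⟨n, φ, hφ, hcov ▸ Set.subset_univ _⟩
  tfae_have 3 → 5 := fun h D hD => HasFiniteCover.hasFiniteIndexImage hinj hD (h D hD)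
  tfae_have 5 → 3 := fun h D hD => HasFiniteIndexImage.hasFiniteCover (h D hD)
  tfae_have 5 → 4 := fun h C D hC hD => HasFiniteIndexImage.exists_le hinj hC (h D hD)
  tfae_have 4 → 5 := by
    intro h D hD
    obtain ⟨φ, D', hφ, hD', hsub, B, hB, -, hind⟩ := h ⊤ D .top hD
    exact ⟨φ, D', hφ, hD', hsub, B, hB, by rwa [Subgroup.relIndex_top_right] at hind⟩
  tfae_have 5 ↔ 6 := forall_hasFiniteIndexImage_iff hinj
  tfae_finish
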